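/- arXiv:1302.6653 — 3 statements merged into one kernel-verified Lean document; each statement's English description precedes it below -/
import Mathlib

section
/- If three dyadic intervals of the same level are all contained in a half-open interval, then the dyadic parent of the middle one is also contained in it: for all n ∈ ℕ with n ≥ 1, integers k₁ < k₂ < k₃, and a, b ∈ ℝ, if D(n,k₁) ⊆ [a,b), D(n,k₂) ⊆ [a,b), and D(n,k₃) ⊆ [a,b), then D(n−1, ⌊k₂/2⌋) ⊆ [a,b). -/
/-- The dyadic interval `D(n,k) = [k/2^n, (k+1)/2^n) ⊆ ℝ`. -/
def dyadic (n : ℕ) (k : ℤ) : Set ℝ :=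
  Set.Ico ((k : ℝ) / 2 ^ n) (((k : ℝ) + 1) / 2 ^ n)

theorem dyadic_subset_Ico_iff {n : ℕ} {k : ℤ} {a b : ℝ} :
    dyadic n k ⊆ Set.Ico a b ↔ a ≤ (k : ℝ) / 2 ^ n ∧ ((k : ℝ) + 1) / 2 ^ n ≤ b :=
  Set.Ico_subset_Ico_iff (by gcongr; linarith)

/-- If three dyadic intervals of the same level are all contained in a half-open
interval, then the dyadic parent of the middle one is also contained in it. -/
theorem middle_parent_subset (n : ℕ) (hn : 1 ≤ n) (k₁ k₂ k₃ : ℤ)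
    (h12 : k₁ < k₂) (h23 : k₂ < k₃) (a b : ℝ)
    (h1 : dyadic n k₁ ⊆ Set.Ico a b)
    (h2 : dyadic n k₂ ⊆ Set.Ico a b)
    (h3 : dyadic n k₃ ⊆ Set.Ico a b) :
    dyadic (n - 1) ⌊(k₂ : ℝ) / 2⌋ ⊆ Set.Ico a b := by
  obtain ⟨m, rfl⟩ := Nat.exists_eq_add_of_le' hn
  rw [dyadic_subset_Ico_iff] at h1 h3 ⊢
  rw [Nat.add_sub_cancel]
  set j := ⌊(k₂ : ℝ) / 2⌋ with hj
  obtain ⟨hle, hlt⟩ := Int.floor_eq_iff.mp hj.symm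
  have hle' : 2 * j ≤ k₂ := by
    have : (2 * j : ℝ) ≤ k₂ := by linarith
    exact_mod_cast this
  have hlt' : k₂ < 2 * j + 2 := by
    have : (k₂ : ℝ) < 2 * j + 2 := by linarith
    exact_mod_cast this
  have hk₁ : (k₁ : ℝ) ≤ 2 * j := by
    have : k₁ ≤ 2 * j := by lia
    exact_mod_cast this
  have hk₃ : 2 * ((j : ℝ) + 1) ≤ k₃ + 1 := by
    have : 2 * (j + 1) ≤ k₃ + 1 := by lia
    exact_mod_cast this
  have scale (x : ℝ) : x / 2 ^ m = 2 * x / 2 ^ (m + 1) := by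
    rw [pow_succ']
    field_simp
  constructor
  · rw [scale]
    exact h1.1.trans (by gcongr)
  · rw [scale]
    exact le_trans (by gcongr) h3.2
end

section
/- At most four dyadic intervals of any given level meet a half-open interval while either not being contained in it or being a maximal contained piece: for all a, b ∈ ℝ and n ∈ ℕ with n ≥ 1, the set {k ∈ ℤ : D(n,k) ∩ [a,b) ≠ ∅ and (¬(D(n,k) ⊆ [a,b)) or ¬(D(n−1, ⌊k/2⌋) ⊆ [a,b)))} is finite and has at most 4 elements. -/
theorem mem_dyadic_iff {n : ℕ} {k : ℤ} {x : ℝ} : x ∈ dyadic n k ↔ ⌊x * 2 ^ n⌋ = k := by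
  have h : (0 : ℝ) < 2 ^ n := by positivity
  rw [Int.floor_eq_iff, dyadic, Set.mem_Ico, div_le_iff₀ h, lt_div_iff₀ h]

theorem ordConnected_dyadic (n : ℕ) (k : ℤ) : (dyadic n k).OrdConnected :=
  Set.ordConnected_Ico

theorem floor_intCast_div_two_bounds (k : ℤ) :
    2 * ⌊(k : ℝ) / 2⌋ ≤ k ∧ k ≤ 2 * ⌊(k : ℝ) / 2⌋ + 1 := by
  have h₁ := Int.floor_le ((k : ℝ) / 2)
  have h₂ := Int.lt_floor_add_one ((k : ℝ) / 2)
  constructor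
  · exact_mod_cast (by linarith : 2 * (⌊(k : ℝ) / 2⌋ : ℝ) ≤ k)
  · have : k < 2 * ⌊(k : ℝ) / 2⌋ + 2 := by
      exact_mod_cast (by linarith : (k : ℝ) < 2 * (⌊(k : ℝ) / 2⌋ : ℝ) + 2)
    omega

theorem dyadic_succ_subset_parent (n : ℕ) (k : ℤ) :
    dyadic (n + 1) k ⊆ dyadic n ⌊(k : ℝ) / 2⌋ := by
  intro x hx
  obtain ⟨h₁, h₂⟩ := floor_intCast_div_two_bounds k
  have h₁' : 2 * (⌊(k : ℝ) / 2⌋ : ℝ) ≤ k := by exact_mod_cast h₁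
  have h₂' : (k : ℝ) ≤ 2 * (⌊(k : ℝ) / 2⌋ : ℝ) + 1 := by exact_mod_cast h₂
  rw [mem_dyadic_iff, Int.floor_eq_iff, pow_succ] at hx
  rw [mem_dyadic_iff, Int.floor_eq_iff]
  constructor <;> linarith

/-- An order-connected set that meets `[a, b)` without being contained in it contains an
endpoint. -/
theorem Set.OrdConnected.mem_or_mem_of_not_subset_Ico {α : Type*} [LinearOrder α] {s : Set α}
    (hs : s.OrdConnected) {a b : α} (hne : (s ∩ Set.Ico a b).Nonempty)
    (hsub : ¬ s ⊆ Set.Ico a b) : a ∈ s ∨ b ∈ s := by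
  obtain ⟨y, hy, hay, hyb⟩ := hne
  obtain ⟨x, hx, hxab⟩ := Set.not_subset.mp hsub
  rcases lt_or_ge x a with hxa | hax
  · exact Or.inl (hs.out hx hy ⟨hxa.le, hay⟩)
  · exact Or.inr (hs.out hy hx ⟨hyb.le, not_lt.mp fun h => hxab ⟨hax, h⟩⟩)

/-- At most four dyadic intervals of any given level meet a half-open interval
while either not being contained in it or being a maximal contained piece. -/
theorem dyadic_ancestors_le_four (a b : ℝ) (n : ℕ) (hn : 1 ≤ n) :
    {k : ℤ | (dyadic n k ∩ Set.Ico a b).Nonempty ∧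
        (¬ dyadic n k ⊆ Set.Ico a b ∨
          ¬ dyadic (n - 1) ⌊(k : ℝ) / 2⌋ ⊆ Set.Ico a b)}.Finite ∧
      {k : ℤ | (dyadic n k ∩ Set.Ico a b).Nonempty ∧
        (¬ dyadic n k ⊆ Set.Ico a b ∨
          ¬ dyadic (n - 1) ⌊(k : ℝ) / 2⌋ ⊆ Set.Ico a b)}.ncard ≤ 4 := by
  obtain ⟨m, rfl⟩ := Nat.exists_eq_add_of_le' hn
  simp only [Nat.add_sub_cancel]
  set i := ⌊a * 2 ^ m⌋
  set j := ⌊b * 2 ^ m⌋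
  have hS : {k : ℤ | (dyadic (m + 1) k ∩ Set.Ico a b).Nonempty ∧
      (¬ dyadic (m + 1) k ⊆ Set.Ico a b ∨ ¬ dyadic m ⌊(k : ℝ) / 2⌋ ⊆ Set.Ico a b)} ⊆
      (({2 * i, 2 * i + 1, 2 * j, 2 * j + 1} : Finset ℤ) : Set ℤ) := by
    rintro k ⟨hne, hsub⟩
    have hchild := dyadic_succ_subset_parent m k
    have hparent : ¬ dyadic m ⌊(k : ℝ) / 2⌋ ⊆ Set.Ico a b :=
      hsub.elim (fun h h' => h (hchild.trans h')) id
    have hend := (ordConnected_dyadic m _).mem_or_mem_of_not_subset_Ico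
      (hne.mono (Set.inter_subset_inter_left _ hchild)) hparent
    rw [mem_dyadic_iff, mem_dyadic_iff] at hend
    have hk := floor_intCast_div_two_bounds k
    simp only [Finset.coe_insert, Finset.coe_singleton, Set.mem_insert_iff,
      Set.mem_singleton_iff]
    omega
  refine ⟨(Finset.finite_toSet _).subset hS, ?_⟩
  refine (Set.ncard_le_ncard hS (Finset.finite_toSet _)).trans ?_
  rw [Set.ncard_coe_finset]
  exact Finset.card_le_four
end

section
/- If five dyadic intervals of the same level all meet a half-open interval, then the dyadic parent of the middle one is contained in it: for all n ∈ ℕ with n ≥ 1, integers k₁ < k₂ < k₃ < k₄ < k₅, and a, b ∈ ℝ, if D(n,kᵢ) ∩ [a,b) ≠ ∅ for each i ∈ {1,2,3,4,5}, then D(n−1, ⌊k₃/2⌋) ⊆ [a,b). -/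
/-- If five dyadic intervals of the same level all meet a half-open interval,
then the dyadic parent of the middle one is contained in it. -/
theorem middle_of_five_parent_subset (n : ℕ) (hn : 1 ≤ n)
    (k₁ k₂ k₃ k₄ k₅ : ℤ)
    (h12 : k₁ < k₂) (h23 : k₂ < k₃) (h34 : k₃ < k₄) (h45 : k₄ < k₅)
    (a b : ℝ)
    (h1 : (dyadic n k₁ ∩ Set.Ico a b).Nonempty)
    (h2 : (dyadic n k₂ ∩ Set.Ico a b).Nonempty)
    (h3 : (dyadic n k₃ ∩ Set.Ico a b).Nonempty)
    (h4 : (dyadic n k₄ ∩ Set.Ico a b).Nonempty)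
    (h5 : (dyadic n k₅ ∩ Set.Ico a b).Nonempty) :
    dyadic (n - 1) ⌊(k₃ : ℝ) / 2⌋ ⊆ Set.Ico a b := by
  obtain ⟨x, ⟨-, hx⟩, ⟨hax, -⟩⟩ := h1
  obtain ⟨y, ⟨hy, -⟩, ⟨-, hyb⟩⟩ := h5
  obtain ⟨m, rfl⟩ : ∃ m, n = m + 1 := ⟨n - 1, by omega⟩
  rw [Nat.add_sub_cancel]
  set q : ℤ := ⌊(k₃ : ℝ) / 2⌋
  have hq_le : (q : ℝ) ≤ (k₃ : ℝ) / 2 := Int.floor_le _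
  have hq_lt : (k₃ : ℝ) / 2 < q + 1 := Int.lt_floor_add_one _
  have hq_lt' : k₃ < 2 * q + 2 := by
    have : (k₃ : ℝ) < 2 * q + 2 := by linarith
    exact_mod_cast this
  have hleft : (k₁ : ℝ) + 1 ≤ 2 * q := by
    have : k₁ + 1 ≤ 2 * q := by omega
    exact_mod_cast this
  have hright : 2 * (q : ℝ) + 2 ≤ k₅ := by
    have : (k₃ : ℝ) + 2 ≤ k₅ := by exact_mod_cast (by omega : k₃ + 2 ≤ k₅)
    linarith
  have hpos : (0 : ℝ) < 2 ^ m := by positivity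
  have hpos' : (0 : ℝ) < 2 ^ (m + 1) := by positivity
  rintro z ⟨hz, hz'⟩
  rw [div_le_iff₀ hpos] at hz
  rw [lt_div_iff₀ hpos] at hz'
  rw [lt_div_iff₀ hpos', pow_succ] at hx
  rw [div_le_iff₀ hpos', pow_succ] at hy
  have hxz : x < z := lt_of_mul_lt_mul_right (by linarith) hpos.le
  have hzy : z < y := lt_of_mul_lt_mul_right (by linarith) hpos.le
  exact ⟨hax.trans hxz.le, hzy.trans hyb⟩
end
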